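/- arXiv:2006.08909 — 4 statements merged into one kernel-verified Lean document; each statement's English description precedes it below -/
import Mathlib

section
/- Let (b_n)_{n≥0} be the increasing enumeration of the positive integers whose odd part is congruent to 3 modulo 4. Then for all n ≥ 0, b_n - s_{b_n} = 2n + 1. -/
/-- The sequence `j`: `j 0 = 0`, `j (2k) = j k`, `j (2k+1) = (-1)^k`. -/
def j : ℕ → ℤ
  | 0 => 0
  | (n+1) =>
      if (n+1) % 2 = 1 then (-1 : ℤ) ^ ((n+1)/2)
      else j ((n+1)/2)
decreasing_by omega

/-- `s n = 1 + ∑_{k=0}^{n} j k`. -/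
def s (n : ℕ) : ℤ := 1 + ∑ k ∈ Finset.range (n+1), j k

/-- The odd part (largest odd divisor) of a positive integer. -/
def oddPart (m : ℕ) : ℕ := m / 2 ^ (m.factorization 2)

theorem j_zero : j 0 = 0 := by rw [j]

theorem j_odd (k : ℕ) : j (2 * k + 1) = (-1) ^ k := by
  rw [j, if_pos (by omega), show (2 * k + 1) / 2 = k by omega]

theorem j_even (k : ℕ) : j (2 * k) = j k := by
  cases k with
  | zero => rfl
  | succ k =>
    rw [show 2 * (k + 1) = (2 * k + 1) + 1 by ring, j, if_neg (by omega),
      show (2 * k + 1 + 1) / 2 = k + 1 by omega]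

theorem oddPart_odd (k : ℕ) : oddPart (2 * k + 1) = 2 * k + 1 := by
  rw [oddPart, Nat.factorization_eq_zero_of_not_dvd (by omega), pow_zero, Nat.div_one]

theorem oddPart_even {k : ℕ} (hk : k ≠ 0) : oddPart (2 * k) = oddPart k := by
  have h : (2 * k).factorization 2 = k.factorization 2 + 1 := by
    rw [Nat.factorization_mul two_ne_zero hk, Finsupp.add_apply,
      Nat.prime_two.factorization_self, add_comm]
  rw [oddPart, oddPart, h, pow_succ', Nat.mul_div_mul_left _ _ two_pos]

theorem j_eq_ite_oddPart {m : ℕ} (hm : 0 < m) :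
    j m = if oddPart m % 4 = 3 then -1 else 1 := by
  induction m using Nat.strong_induction_on with
  | _ m ih =>
    obtain ⟨k, rfl | rfl⟩ := Nat.even_or_odd' m
    · rw [j_even, oddPart_even (by omega)]
      exact ih k (by omega) (by omega)
    · rw [j_odd, oddPart_odd]
      rcases Nat.even_or_odd k with hk | hk
      · rw [hk.neg_one_pow, if_neg (by rcases hk with ⟨r, rfl⟩; omega)]
      · rw [hk.neg_one_pow, if_pos (by rcases hk with ⟨r, rfl⟩; omega)]

theorem sub_s_eq_count (m : ℕ) :
    (m : ℤ) - s m = 2 * (Nat.count (fun k => 0 < k ∧ oddPart k % 4 = 3) (m + 1) : ℤ) - 1 := by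
  induction m with
  | zero => simp [s, j_zero, Nat.count_succ]
  | succ m ih =>
    have hs : s (m + 1) = s m + j (m + 1) := by
      rw [s, s, Finset.sum_range_succ _ (m + 1), add_assoc]
    rw [hs, j_eq_ite_oddPart m.succ_pos, Nat.count_succ]
    simp only [Nat.succ_pos, true_and]
    split_ifs <;> push_cast <;> linarith

theorem count_strictMono_of_range {p : ℕ → Prop} [DecidablePred p] {b : ℕ → ℕ}
    (hb : StrictMono b) (hp : ∀ m, (∃ n, b n = m) ↔ p m) (n : ℕ) :
    Nat.count p (b n) = n := by
  have h : (Finset.range (b n)).filter p = (Finset.range n).image b := by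
    ext m
    simp only [Finset.mem_filter, Finset.mem_range, Finset.mem_image, ← hp]
    constructor
    · rintro ⟨hm, i, rfl⟩
      exact ⟨i, hb.lt_iff_lt.1 hm, rfl⟩
    · rintro ⟨i, hi, rfl⟩
      exact ⟨hb hi, i, rfl⟩
  rw [Nat.count_eq_card_filter_range, h, Finset.card_image_of_injective _ hb.injective,
    Finset.card_range]

theorem stmt4 (b : ℕ → ℕ) (hb : StrictMono b)
    (hrange : ∀ m : ℕ,
      ((∃ n, b n = m) ↔ 0 < m ∧ oddPart m % 4 = 3)) :
    ∀ n : ℕ, (b n : ℤ) - s (b n) = 2 * n + 1 := by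
  intro n
  rw [sub_s_eq_count, Nat.count_succ, count_strictMono_of_range hb hrange,
    if_pos ((hrange _).1 ⟨n, rfl⟩)]
  push_cast
  ring
end

section
/- For two consecutive positive integers, the numbers of runs in their binary expansions differ by exactly 1 in absolute value; consequently |s_{n+1} - s_n| ≤ 1 for all n ≥ 0. -/
/-- The number of runs (maximal blocks of equal consecutive digits) in the
binary expansion of `n`; the expansion of `0` is empty and has `0` runs. -/
def runCount (n : ℕ) : ℕ := ((Nat.digits 2 n).destutter (· ≠ ·)).length

theorem runCount_two_mul (k : ℕ) : runCount (2 * k) = runCount k + k % 2 := by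
  rcases k.eq_zero_or_pos with rfl | hk
  · simp
  · unfold runCount
    rw [Nat.digits_def' (by norm_num) (by omega : 0 < 2 * k), Nat.mul_mod_right,
      Nat.mul_div_cancel_left k (by norm_num), Nat.digits_def' (by norm_num) hk]
    rcases Nat.mod_two_eq_zero_or_one k with h | h <;>
      simp [h, List.destutter_cons']

theorem runCount_two_mul_add_one (k : ℕ) :
    runCount (2 * k + 1) = runCount k + (1 - k % 2) := by
  rcases k.eq_zero_or_pos with rfl | hk
  · simp [runCount]
  · unfold runCount
    rw [Nat.digits_def' (by norm_num) (by omega : 0 < 2 * k + 1),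
      show (2 * k + 1) % 2 = 1 by omega, show (2 * k + 1) / 2 = k by omega,
      Nat.digits_def' (by norm_num) hk]
    rcases Nat.mod_two_eq_zero_or_one k with h | h <;>
      simp [h, List.destutter_cons']

theorem abs_runCount_succ_sub (n : ℕ) :
    |(runCount (n + 1) : ℤ) - (runCount n : ℤ)| = 1 := by
  induction n using Nat.strong_induction_on with
  | _ n ih =>
    obtain ⟨k, rfl | rfl⟩ := n.even_or_odd'
    · rw [runCount_two_mul, runCount_two_mul_add_one]
      rcases Nat.mod_two_eq_zero_or_one k with h | h <;> simp [h]
    · have hk := ih k (by omega)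
      rw [show 2 * k + 1 + 1 = 2 * (k + 1) by ring, runCount_two_mul, runCount_two_mul_add_one,
        show (k + 1) % 2 = 1 - k % 2 by omega]
      push_cast
      rwa [add_sub_add_right_eq_sub]

theorem abs_j_le_one (n : ℕ) : |j n| ≤ 1 := by
  induction n using Nat.strong_induction_on with
  | _ n ih =>
    cases n with
    | zero => simp [j]
    | succ n =>
      rw [j]
      split_ifs
      · simp [abs_pow]
      · exact ih _ (by omega)

theorem stmt7 :
    (∀ n : ℕ, 0 < n → |(runCount (n+1) : ℤ) - (runCount n : ℤ)| = 1) ∧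
    (∀ n : ℕ, |s (n+1) - s n| ≤ 1) := by
  refine ⟨fun n _ => abs_runCount_succ_sub n, fun n => ?_⟩
  rw [s, s, Finset.sum_range_succ _ (n + 1), add_sub_add_left_eq_sub, add_sub_cancel_left]
  exact abs_j_le_one (n + 1)
end

section
/- Let h_n be the n-th Hankel determinant of the coefficient sequence of B(x) = 1 - x·r(x). Then |h_0| = |h_1| = 1, and for every n ≥ 2, if k ≥ 0 is the unique integer with 2^k < n ≤ 2^{k+1}, then |h_n| = |h_{2^{k+1} - n + 1}| + 1. -/
/-- The `n`-th Hankel determinant of the sequence `a`: the determinant of the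
`n × n` matrix whose `(i,j)` entry is `a (i + j)` (with `H_0 = 1`). -/
def hankel (a : ℕ → ℤ) (n : ℕ) : ℤ :=
  Matrix.det (Matrix.of fun i j : Fin n => a (i.1 + j.1))

open scoped Classical in
/-- The Rueppel sequence: `r n = 1` if `n = 2^m - 1` for some `m`, else `0`. -/
noncomputable def ruep (n : ℕ) : ℤ := if ∃ m : ℕ, n = 2 ^ m - 1 then 1 else 0

/-- Hankel determinants of the shifted negated Rueppel sequence `(-r_{n+1})`. -/
noncomputable def g (n : ℕ) : ℤ := hankel (fun i => -ruep (i + 1)) n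

/-- Coefficient sequence of `B(x) = 1 - x·r(x)`. -/
noncomputable def bseq : ℕ → ℤ
  | 0 => 1
  | (n+1) => -ruep n

/-- Hankel determinants of the coefficient sequence of `1 - x·r(x)`. -/
noncomputable def h (n : ℕ) : ℤ := hankel bseq n

theorem ruep_two_pow_sub_one (k : ℕ) : ruep (2 ^ k - 1) = 1 :=
  if_pos ⟨k, rfl⟩

theorem bseq_two_pow (k : ℕ) : bseq (2 ^ k) = -1 := by
  have hk : 2 ^ k = (2 ^ k - 1) + 1 := by have := Nat.one_le_two_pow (n := k); omega
  rw [hk, bseq, ruep_two_pow_sub_one]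

theorem bseq_eq_zero {k i : ℕ} (h₁ : 2 ^ k < i) (h₂ : i < 2 ^ (k + 1)) : bseq i = 0 := by
  obtain ⟨i, rfl⟩ : ∃ l, i = l + 1 := ⟨i - 1, by omega⟩
  rw [bseq, ruep, if_neg, neg_zero]
  rintro ⟨m, hm⟩
  have hpos := Nat.one_le_two_pow (n := m)
  have hi : i + 1 = 2 ^ m := by omega
  rw [hi] at h₁ h₂
  have := (Nat.pow_lt_pow_iff_right (by norm_num : 1 < 2)).1 h₁
  have := (Nat.pow_lt_pow_iff_right (by norm_num : 1 < 2)).1 h₂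
  omega

/-- The `n × n` Hankel matrix of `bseq` with `t` added to its top left entry. -/
noncomputable def cornerHankel (n : ℕ) (t : ℤ) : Matrix (Fin n) (Fin n) ℤ :=
  Matrix.of fun i j => bseq (i + j) + if (i : ℕ) = 0 ∧ (j : ℕ) = 0 then t else 0

theorem h_eq_det_cornerHankel (n : ℕ) : h n = (cornerHankel n 0).det := by
  simp [h, hankel, cornerHankel]

/-- A square matrix vanishing below its antidiagonal, with units on it, has an inverse
vanishing above the antidiagonal. -/
theorem exists_right_inverse_of_antitriangular {s : ℕ} (D : Matrix (Fin s) (Fin s) ℤ)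
    (hzero : ∀ i j : Fin s, s ≤ (i : ℕ) + j → D i j = 0)
    (hunit : ∀ i : Fin s, IsUnit (D i i.rev)) :
    ∃ L : Matrix (Fin s) (Fin s) ℤ, D * L = 1 ∧
      ∀ i j : Fin s, (i : ℕ) + j + 1 < s → L i j = 0 := by
  set T := D.submatrix id Fin.revPerm with hT
  have htri : T.BlockTriangular id := fun i j hij => by
    apply hzero
    have : (j : ℕ) < i := hij
    simp only [id, Fin.revPerm_apply, Fin.val_rev]
    omega
  have hdet : IsUnit T.det := by
    rw [Matrix.det_of_isUpperTriangular htri]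
    exact IsUnit.prod_univ_iff.2 hunit
  let := T.invertibleOfIsUnitDet hdet
  have hinv := Matrix.blockTriangular_inv_of_blockTriangular htri
  refine ⟨T⁻¹.submatrix Fin.revPerm id, ?_, fun i j hij => hinv ?_⟩
  · have hD : D = T.submatrix id Fin.revPerm := by ext; simp [hT]
    rw [hD, Matrix.submatrix_mul_equiv, Matrix.mul_nonsing_inv _ hdet, Matrix.submatrix_id_id]
  · simp only [id, Fin.revPerm_apply, Fin.lt_def, Fin.val_rev]
    omega

/-- If the outer factors vanish beyond the middle index `p` and the inner one vanishes above the
antidiagonal, only the middle term of the triple product survives. -/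
theorem mul_mul_apply_of_middle {m p : ℕ} {U : Matrix (Fin m) (Fin (2 * p + 1)) ℤ}
    {L : Matrix (Fin (2 * p + 1)) (Fin (2 * p + 1)) ℤ} {V : Matrix (Fin (2 * p + 1)) (Fin m) ℤ}
    (c : Fin (2 * p + 1)) (hc : (c : ℕ) = p) {i j : Fin m}
    (hU : ∀ a, c < a → U i a = 0) (hV : ∀ a, c < a → V a j = 0)
    (hL : ∀ a b : Fin (2 * p + 1), (a : ℕ) + b + 1 < 2 * p + 1 → L a b = 0) :
    (U * L * V) i j = U i c * L c c * V c j := by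
  rw [Matrix.mul_apply, Finset.sum_eq_single c, Matrix.mul_apply, Finset.sum_eq_single c]
  · intro a _ ha
    rcases lt_or_gt_of_ne ha with h | h
    · rw [hL a c (by omega), mul_zero]
    · rw [hU a h, zero_mul]
  · simp
  · intro b _ hb
    rcases lt_or_gt_of_ne hb with h | h
    · rw [Matrix.mul_apply, Finset.sum_eq_zero, zero_mul]
      intro a _
      rcases le_or_gt a c with h' | h'
      · rw [hL a b (by omega), mul_zero]
      · rw [hU a h', zero_mul]
    · rw [hV b h, mul_zero]
  · simp

theorem exists_det_cornerHankel_eq {k m p : ℕ} (hm : 1 ≤ m) (hk : 2 ^ k = m + p) :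
    ∃ ε : ℤ, IsUnit ε ∧ ∀ t : ℤ,
      (cornerHankel (m + (2 * p + 1)) t).det = ε * (cornerHankel m (t + 1)).det := by
  have hk' : 2 ^ (k + 1) = 2 * (m + p) := by rw [pow_succ, hk, mul_comm]
  have hk'' : 2 ^ (k + 1 + 1) = 4 * (m + p) := by rw [pow_succ, hk']; ring
  let D : Matrix (Fin (2 * p + 1)) (Fin (2 * p + 1)) ℤ :=
    Matrix.of fun a b => bseq ((m + a) + (m + b))
  let U : Matrix (Fin m) (Fin (2 * p + 1)) ℤ := Matrix.of fun i b => bseq (i + (m + b))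
  let V : Matrix (Fin (2 * p + 1)) (Fin m) ℤ := Matrix.of fun a j => bseq ((m + a) + j)
  let c : Fin (2 * p + 1) := ⟨p, by omega⟩
  have hD (a b : Fin (2 * p + 1)) (hab : 2 * p + 1 ≤ (a : ℕ) + b) : D a b = 0 :=
    bseq_eq_zero (k := k + 1) (by omega) (by omega)
  have hD' (a b : Fin (2 * p + 1)) (hab : (a : ℕ) + b = 2 * p) : D a b = -1 := by
    rw [← bseq_two_pow (k + 1)]
    exact congrArg bseq (by omega)
  obtain ⟨L, hDL, hL⟩ := exists_right_inverse_of_antitriangular D hD fun a => by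
    rw [hD' a a.rev (by rw [Fin.val_rev]; omega)]
    exact isUnit_one.neg
  have hcc : L c c = -1 := by
    have h := congrFun (congrFun hDL c) c
    rw [Matrix.mul_apply, Finset.sum_eq_single c, hD' c c (by simp only [c]; omega),
      Matrix.one_apply_eq] at h
    · omega
    · intro a _ ha
      rcases lt_or_gt_of_ne ha with h | h
      · rw [hL a c (by simp only [c, Fin.lt_def] at h ⊢; omega), mul_zero]
      · rw [hD c a (by simp only [c, Fin.lt_def] at h ⊢; omega), zero_mul]
    · simp
  have hU (i : Fin m) (a : Fin (2 * p + 1)) (ha : c < a) : U i a = 0 :=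
    bseq_eq_zero (k := k) (by simp only [c, Fin.lt_def] at ha; omega) (by omega)
  have hUc (i : Fin m) : U i c = if (i : ℕ) = 0 then -1 else 0 := by
    split_ifs with hi
    · rw [← bseq_two_pow k]
      exact congrArg bseq (by simp only [c]; omega)
    · exact bseq_eq_zero (k := k) (by simp only [c]; omega) (by simp only [c]; omega)
  have hVU (a : Fin (2 * p + 1)) (j : Fin m) : V a j = U j a := congrArg bseq (add_comm _ _)
  refine ⟨D.det, Matrix.isUnit_det_of_right_inverse hDL, fun t => ?_⟩
  have hblocks : (cornerHankel (m + (2 * p + 1)) t).submatrix finSumFinEquiv finSumFinEquiv =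
      Matrix.fromBlocks (cornerHankel m t) U V D := by
    ext (i | i) (j | j) <;>
      simp only [cornerHankel, U, V, D, Matrix.submatrix_apply, Matrix.of_apply,
        finSumFinEquiv_apply_left, finSumFinEquiv_apply_right, Fin.val_castAdd, Fin.val_natAdd,
        Matrix.fromBlocks_apply₁₁, Matrix.fromBlocks_apply₁₂, Matrix.fromBlocks_apply₂₁,
        Matrix.fromBlocks_apply₂₂] <;>
      rw [if_neg (by omega), add_zero]
  let := Matrix.invertibleOfIsUnitDet D (Matrix.isUnit_det_of_right_inverse hDL)
  have hinv : ⅟D = L := invOf_eq_right_inv hDL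
  rw [← Matrix.det_submatrix_equiv_self finSumFinEquiv, hblocks, Matrix.det_fromBlocks₂₂, hinv]
  congr 2
  ext i j
  rw [Matrix.sub_apply, mul_mul_apply_of_middle c rfl (hU i)
    (fun a ha => by rw [hVU, hU j a ha]) hL, hVU, hcc, hUc, hUc]
  by_cases hi : (i : ℕ) = 0 <;> by_cases hj : (j : ℕ) = 0 <;> simp [cornerHankel, hi, hj]
  ring

theorem exists_det_cornerHankel_eq_of_lt {n k : ℕ} (h₁ : 2 ^ k < n) (h₂ : n ≤ 2 ^ (k + 1)) :
    ∃ ε : ℤ, IsUnit ε ∧ ∀ t : ℤ, (cornerHankel n t).det =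
      ε * (cornerHankel (2 ^ (k + 1) - n + 1) (t + 1)).det := by
  rw [pow_succ] at h₂ ⊢
  obtain ⟨p, hp⟩ : ∃ p, 2 ^ k = (2 ^ k * 2 - n + 1) + p := Nat.exists_eq_add_of_le (by omega)
  have := exists_det_cornerHankel_eq (by omega) hp
  rwa [show 2 ^ k * 2 - n + 1 + (2 * p + 1) = n by omega] at this

theorem exists_det_cornerHankel_eq_mul_add (n : ℕ) (hn : 1 ≤ n) :
    ∃ ε c : ℤ, IsUnit ε ∧ 1 ≤ c ∧ ∀ t : ℤ, (cornerHankel n t).det = ε * (t + c) := by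
  induction n using Nat.strong_induction_on with
  | _ n ih =>
    obtain rfl | hn := hn.eq_or_lt
    · exact ⟨1, 1, isUnit_one, le_rfl, fun t => by simp [cornerHankel, bseq, add_comm]⟩
    · have h₁ : 2 ^ (Nat.log 2 (n - 1)) < n := by
        have := Nat.pow_log_le_self 2 (show n - 1 ≠ 0 by omega)
        omega
      have h₂ : n ≤ 2 ^ (Nat.log 2 (n - 1) + 1) := by
        have := Nat.lt_pow_succ_log_self (b := 2) (by norm_num) (n - 1)
        simp only [Nat.succ_eq_add_one] at this
        omega
      obtain ⟨ε, hε, h⟩ := exists_det_cornerHankel_eq_of_lt h₁ h₂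
      have hlt : 2 ^ (Nat.log 2 (n - 1) + 1) - n + 1 < n := by
        rw [pow_succ] at h₂ ⊢
        omega
      obtain ⟨δ, c, hδ, hc, h'⟩ := ih _ hlt le_add_self
      exact ⟨ε * δ, c + 1, hε.mul hδ, by omega, fun t => by rw [h, h']; ring⟩

theorem stmt11 :
    |h 0| = 1 ∧ |h 1| = 1 ∧
    ∀ n k : ℕ, 2 ≤ n → 2 ^ k < n → n ≤ 2 ^ (k + 1) →
      |h n| = |h (2 ^ (k + 1) - n + 1)| + 1 := by
  refine ⟨by simp [h, hankel], by simp [h, hankel, bseq], fun n k _ h₁ h₂ => ?_⟩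
  obtain ⟨ε, hε, hn⟩ := exists_det_cornerHankel_eq_of_lt h₁ h₂
  obtain ⟨δ, c, hδ, hc, hm⟩ := exists_det_cornerHankel_eq_mul_add (2 ^ (k + 1) - n + 1) le_add_self
  rw [h_eq_det_cornerHankel, h_eq_det_cornerHankel, hn, hm, hm, abs_mul, abs_mul, abs_mul,
    Int.isUnit_iff_abs_eq.1 hε, Int.isUnit_iff_abs_eq.1 hδ, abs_of_pos (by omega),
    abs_of_pos (by omega)]
  ring
end

section
/- Let h_n be the n-th Hankel determinant of the coefficient sequence of B(x) = 1 - x·r(x). Then for all n ≥ 0 the following linear relations hold: h_{8n} = h_{4n}, h_{8n+1} = h_{4n+1}, h_{8n+2} = h_{4n+2}, h_{8n+3} = -h_{4n+1} - 2h_{4n+2}, h_{8n+4} = -h_{4n+2}, h_{8n+5} = -h_{4n+3}, h_{8n+6} = -h_{2n+1} + h_{4n+1} + h_{4n+2} + 2h_{4n+3}, and h_{8n+7} = h_{4n+3}. (In particular (h_n) is a 2-regular sequence.) -/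
lemma hankel_eq_det_parity_blocks (a : ℕ → ℤ) (p q : ℕ) (hqp : q ≤ p) (hpq : p ≤ q + 1) :
    hankel a (p + q) = (Matrix.fromBlocks
      (Matrix.of fun i j : Fin p => a (2 * (i.1 + j.1)))
      (Matrix.of fun (i : Fin p) (j : Fin q) => a (2 * (i.1 + j.1) + 1))
      (Matrix.of fun (i : Fin q) (j : Fin p) => a (2 * (i.1 + j.1) + 1))
      (Matrix.of fun i j : Fin q => a (2 * (i.1 + j.1) + 2))).det := by
  let f : Fin p ⊕ Fin q → Fin (p + q) :=
    Sum.elim (fun i => ⟨2 * i.1, by omega⟩) (fun j => ⟨2 * j.1 + 1, by omega⟩)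
  have hf : Function.Bijective f := by
    rw [Fintype.bijective_iff_injective_and_card]
    refine ⟨?_, by simp⟩
    rintro (i | i) (j | j) hij <;> simp only [f, Sum.elim_inl, Sum.elim_inr, Fin.mk.injEq] at hij
    · congr 1; ext; omega
    · omega
    · omega
    · congr 1; ext; omega
  rw [hankel, ← Matrix.det_submatrix_equiv_self (Equiv.ofBijective f hf)]
  congr 1
  ext (i | i) (j | j) <;>
    simp only [f, Matrix.submatrix_apply, Equiv.ofBijective_apply, Sum.elim_inl, Sum.elim_inr,
      Matrix.of_apply, Matrix.fromBlocks_apply₁₁, Matrix.fromBlocks_apply₁₂,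
      Matrix.fromBlocks_apply₂₁, Matrix.fromBlocks_apply₂₂] <;> congr 1 <;> ring

lemma hankel_of_odd_eq_zero (a : ℕ → ℤ) (ha : ∀ k, a (2 * k + 1) = 0) (p q : ℕ)
    (hqp : q ≤ p) (hpq : p ≤ q + 1) :
    hankel a (p + q) = hankel (fun k => a (2 * k)) p * hankel (fun k => a (2 * k + 2)) q := by
  rw [hankel_eq_det_parity_blocks a p q hqp hpq]
  have h0 : (Matrix.of fun (i : Fin q) (j : Fin p) => a (2 * (i.1 + j.1) + 1)) = 0 := by
    ext i j; simp [ha]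
  rw [h0, Matrix.det_fromBlocks_zero₂₁]
  rfl

lemma det_fromBlocks_zero_right {m : ℕ} (E A C : Matrix (Fin m) (Fin m) ℤ) :
    (Matrix.fromBlocks E A C 0).det = (-1) ^ m * (A.det * C.det) := by
  have hJ : (Matrix.fromBlocks (0 : Matrix (Fin m) (Fin m) ℤ) 1 (-1)
      (0 : Matrix (Fin m) (Fin m) ℤ)).det = 1 := by
    have : Matrix.fromBlocks (0 : Matrix (Fin m) (Fin m) ℤ) 1 (-1)
        (0 : Matrix (Fin m) (Fin m) ℤ) =
        Matrix.fromBlocks 1 1 0 1 * Matrix.fromBlocks 1 0 (-1) 1 * Matrix.fromBlocks 1 1 0 1 := by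
      simp [Matrix.fromBlocks_multiply]
    rw [this]
    simp
  have h1 : Matrix.fromBlocks E A C 0 * Matrix.fromBlocks 0 1 (-1) 0 =
      Matrix.fromBlocks (-A) E 0 C := by
    simp [Matrix.fromBlocks_multiply]
  have h2 := congrArg Matrix.det h1
  rw [Matrix.det_mul, hJ, mul_one, Matrix.det_fromBlocks_zero₂₁, Matrix.det_neg] at h2
  rw [h2, Fintype.card_fin, mul_assoc]

lemma hankel_even_of_even_eq_zero (a : ℕ → ℤ) (ha : ∀ k, a (2 * k + 2) = 0) (m : ℕ) :
    hankel a (2 * m) = (-1) ^ m * hankel (fun k => a (2 * k + 1)) m ^ 2 := by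
  rw [two_mul, hankel_eq_det_parity_blocks a m m le_rfl (by omega)]
  have h0 : (Matrix.of fun (i j : Fin m) => a (2 * (i.1 + j.1) + 2)) = 0 := by
    ext i j; simp [ha]
  rw [h0, det_fromBlocks_zero_right, sq]
  rfl

lemma hankel_odd_of_even_eq_zero (a : ℕ → ℤ) (ha : ∀ k, a (2 * k) = 0) (m : ℕ) :
    hankel a (2 * m + 1) = 0 := by
  let M : Matrix (Fin (2 * m + 1)) (Fin (2 * m + 1)) ℤ := Matrix.of fun i j => a (i.1 + j.1)
  let D : Matrix (Fin (2 * m + 1)) (Fin (2 * m + 1)) ℤ := Matrix.diagonal fun i => (-1) ^ i.1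
  have hM : D * M * D = -M := by
    ext i j
    simp only [D, M, Matrix.mul_diagonal, Matrix.diagonal_mul, Matrix.of_apply, Matrix.neg_apply]
    rcases Nat.even_or_odd (i.1 + j.1) with hij | hij
    · obtain ⟨k, hk⟩ := hij
      rw [hk, ← two_mul, ha]; simp
    · have : (-1 : ℤ) ^ i.1 * (-1) ^ j.1 = -1 := by rw [← pow_add, hij.neg_one_pow]
      linear_combination a (i.1 + j.1) * this
  have hD : D * D = 1 := by
    simp only [D, Matrix.diagonal_mul_diagonal, ← pow_add, ← two_mul]
    simp
  have hdet := congrArg Matrix.det hM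
  have hdD := congrArg Matrix.det hD
  rw [Matrix.det_mul, Matrix.det_mul, Matrix.det_neg, Fintype.card_fin] at hdet
  rw [Matrix.det_mul, Matrix.det_one] at hdD
  have hs : (-1 : ℤ) ^ (2 * m + 1) = -1 := by simp [pow_succ, pow_mul]
  rw [hs] at hdet
  have : M.det = 0 := by
    have : D.det * M.det * D.det = M.det := by linear_combination M.det * hdD
    linarith
  exact this

lemma det_updateRow_single_zero {n : ℕ} (M : Matrix (Fin (n + 1)) (Fin (n + 1)) ℤ) :
    (M.updateRow 0 (Pi.single 0 1)).det = (M.submatrix Fin.succ Fin.succ).det := by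
  rw [← Matrix.adjugate_apply, Matrix.adjugate_fin_succ_eq_det_submatrix]
  simp [Fin.succAbove_zero]

lemma det_updateRow_neg_single_zero {n : ℕ} (M : Matrix (Fin (n + 1)) (Fin (n + 1)) ℤ) :
    (M.updateRow 0 (-Pi.single 0 1)).det = -(M.submatrix Fin.succ Fin.succ).det := by
  rw [← neg_one_smul ℤ, Matrix.det_updateRow_smul, det_updateRow_single_zero, neg_one_mul]

lemma hankel_succ (a : ℕ → ℤ) (n : ℕ) :
    hankel a (n + 1) = a 0 * hankel (fun k => a (k + 2)) n
      + hankel (Function.update a 0 0) (n + 1) := by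
  let M : Matrix (Fin (n + 1)) (Fin (n + 1)) ℤ := Matrix.of fun i j => a (i.1 + j.1)
  let N : Matrix (Fin (n + 1)) (Fin (n + 1)) ℤ :=
    Matrix.of fun i j => Function.update a 0 0 (i.1 + j.1)
  have h1 : M = M.updateRow 0 (a 0 • Pi.single 0 1 + N 0) := by
    ext i j
    refine Fin.cases ?_ (fun i => ?_) i
    · refine Fin.cases ?_ (fun j => ?_) j <;> simp [M, N]
    · simp [M, Matrix.updateRow_apply]
  have h2 : M.updateRow 0 (N 0) = N := by
    ext i j
    refine Fin.cases ?_ (fun i => ?_) i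
    · simp
    · simp [M, N, Matrix.updateRow_apply, Function.update_apply]
  have h3 : (M.submatrix Fin.succ Fin.succ).det = hankel (fun k => a (k + 2)) n := by
    rw [hankel]
    congr 1
    ext i j
    simp only [M, Matrix.submatrix_apply, Matrix.of_apply, Fin.val_succ]
    congr 1; ring
  have h4 : M.det = a 0 * hankel (fun k => a (k + 2)) n + N.det := by
    conv_lhs => rw [h1]
    rw [Matrix.det_updateRow_add, Matrix.det_updateRow_smul, det_updateRow_single_zero, h2, h3]
  exact h4

lemma det_fromBlocks_neg_corner {p q : ℕ} (P : Matrix (Fin (p + 1)) (Fin (p + 1)) ℤ)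
    (Q : Matrix (Fin (q + 1)) (Fin (q + 1)) ℤ) :
    (Matrix.fromBlocks P (-Matrix.single 0 0 1) (-Matrix.single 0 0 1) Q).det =
      P.det * Q.det
        - (P.submatrix Fin.succ Fin.succ).det * (Q.submatrix Fin.succ Fin.succ).det := by
  set M := Matrix.fromBlocks P (-Matrix.single 0 0 1) (-Matrix.single 0 0 1) Q with hM
  have h1 : M = M.updateRow (Sum.inr 0)
      ((Sum.elim 0 (Q 0) : Fin (p + 1) ⊕ Fin (q + 1) → ℤ) +
        (Sum.elim (-Pi.single 0 1) 0 : Fin (p + 1) ⊕ Fin (q + 1) → ℤ)) := by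
    ext (i | i) (j | j)
    · simp [hM, Matrix.updateRow_apply]
    · simp [hM, Matrix.updateRow_apply]
    · by_cases hi : i = 0
      · subst hi
        simp [hM, Matrix.single_apply, Pi.single_apply, eq_comm]
      · simp [hM, Matrix.updateRow_apply, hi]
    · by_cases hi : i = 0
      · subst hi
        simp [hM]
      · simp [hM, Matrix.updateRow_apply, hi]
  have h2 : M.updateRow (Sum.inr 0) (Sum.elim 0 (Q 0)) =
      Matrix.fromBlocks P (-Matrix.single 0 0 1) 0 Q := by
    ext (i | i) (j | j)
    · simp [hM, Matrix.updateRow_apply]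
    · simp [hM, Matrix.updateRow_apply]
    · by_cases hi : i = 0
      · subst hi
        simp
      · simp [hM, Matrix.updateRow_apply, hi, Ne.symm hi]
    · by_cases hi : i = 0
      · subst hi
        simp
      · simp [hM, Matrix.updateRow_apply, hi]
  have h3 : (M.updateRow (Sum.inr 0) (Sum.elim (-Pi.single 0 1) 0)).submatrix
      (Equiv.swap (Sum.inl 0) (Sum.inr 0)) id =
      Matrix.fromBlocks (P.updateRow 0 (-Pi.single 0 1)) 0
        (Matrix.of fun i j => if i = 0 then P 0 j else 0)
        (Q.updateRow 0 (-Pi.single 0 1)) := by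
    ext (i | i) j
    · by_cases hi : i = 0
      · subst hi
        rcases j with j | j <;> simp
      · have hs : Equiv.swap (Sum.inl 0 : Fin (p + 1) ⊕ Fin (q + 1)) (Sum.inr 0) (Sum.inl i)
            = Sum.inl i := Equiv.swap_apply_of_ne_of_ne (by simpa using hi) (by simp)
        rcases j with j | j <;>
          simp [hM, hs, Matrix.updateRow_apply, hi, Ne.symm hi]
    · by_cases hi : i = 0
      · subst hi
        rcases j with j | j <;>
          simp [hM, Matrix.updateRow_apply, Matrix.single_apply, Pi.single_apply, eq_comm]
      · have hs : Equiv.swap (Sum.inl 0 : Fin (p + 1) ⊕ Fin (q + 1)) (Sum.inr 0) (Sum.inr i)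
            = Sum.inr i := Equiv.swap_apply_of_ne_of_ne (by simp) (by simpa using hi)
        rcases j with j | j <;>
          simp [hM, hs, Matrix.updateRow_apply, hi, Ne.symm hi]
  have h4 := congrArg Matrix.det h3
  rw [Matrix.det_permute, Equiv.Perm.sign_swap (by simp), Matrix.det_fromBlocks_zero₁₂,
    det_updateRow_neg_single_zero, det_updateRow_neg_single_zero] at h4
  rw [h1, Matrix.det_updateRow_add, h2, Matrix.det_fromBlocks_zero₂₁]
  push_cast at h4
  linarith

lemma ruep_zero : ruep 0 = 1 := if_pos ⟨0, rfl⟩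

lemma ruep_two_mul_add_one (k : ℕ) : ruep (2 * k + 1) = ruep k := by
  unfold ruep
  congr 1
  refine propext ⟨?_, ?_⟩
  · rintro ⟨_ | m, hm⟩
    · simp at hm
    · exact ⟨m, by rw [pow_succ] at hm; omega⟩
  · rintro ⟨m, hm⟩
    have := Nat.one_le_two_pow (n := m)
    exact ⟨m + 1, by rw [pow_succ]; omega⟩

lemma ruep_two_mul_add_two (k : ℕ) : ruep (2 * k + 2) = 0 := by
  refine if_neg ?_
  rintro ⟨_ | m, hm⟩
  · simp at hm
  · rw [pow_succ] at hm; omega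

lemma ruep_two_mul_add_three (k : ℕ) : ruep (2 * k + 3) = ruep (k + 1) :=
  ruep_two_mul_add_one (k + 1)

lemma bseq_add_one (k : ℕ) : bseq (k + 1) = -ruep k := rfl

lemma bseq_two_mul (k : ℕ) : bseq (2 * k) = bseq k := by
  cases k with
  | zero => rfl
  | succ k => exact congrArg Neg.neg (ruep_two_mul_add_one k)

/-- Hankel determinants of the negated Rueppel sequence. -/
noncomputable def hankelNegRuep (n : ℕ) : ℤ := hankel (fun i => -ruep i) n

/-- Hankel determinants of the twice shifted negated Rueppel sequence. -/
noncomputable def hankelNegRuepShiftTwo (n : ℕ) : ℤ := hankel (fun i => -ruep (i + 2)) n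

lemma hankel_zero (a : ℕ → ℤ) : hankel a 0 = 1 := by simp [hankel]

lemma g_add (p q : ℕ) (hqp : q ≤ p) (hpq : p ≤ q + 1) :
    g (p + q) = hankelNegRuep p * g q := by
  rw [g, hankel_of_odd_eq_zero _ (fun k => by simp [ruep_two_mul_add_two]) p q hqp hpq]
  simp only [add_assoc, Nat.reduceAdd, ruep_two_mul_add_one, ruep_two_mul_add_three]
  rfl

lemma hankelNegRuepShiftTwo_two_mul_eq_g_sq (m : ℕ) :
    hankelNegRuepShiftTwo (2 * m) = (-1) ^ m * g m ^ 2 := by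
  rw [hankelNegRuepShiftTwo, hankel_even_of_even_eq_zero _
    (fun k => neg_eq_zero.mpr (ruep_two_mul_add_two (k + 1)))]
  simp only [add_assoc, Nat.reduceAdd, ruep_two_mul_add_three]
  rfl

lemma hankelNegRuepShiftTwo_two_mul_add_one (m : ℕ) :
    hankelNegRuepShiftTwo (2 * m + 1) = 0 :=
  hankel_odd_of_even_eq_zero _ (fun k => by simp [ruep_two_mul_add_two]) m

lemma hankelNegRuep_two_mul_eq_sq (m : ℕ) :
    hankelNegRuep (2 * m) = (-1) ^ m * hankelNegRuep m ^ 2 := by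
  rw [hankelNegRuep, hankel_even_of_even_eq_zero _ (fun k => by simp [ruep_two_mul_add_two])]
  simp only [ruep_two_mul_add_one]
  rfl

lemma hankelNegRuep_two_mul_add_one_eq_g_sq (m : ℕ) :
    hankelNegRuep (2 * m + 1) = -(-1) ^ m * g m ^ 2 := by
  rw [hankelNegRuep, hankel_succ, hankel_odd_of_even_eq_zero, ruep_zero]
  · have := hankelNegRuepShiftTwo_two_mul_eq_g_sq m
    rw [hankelNegRuepShiftTwo] at this
    rw [this]; ring
  · rintro (_ | k)
    · simp
    · simpa [mul_add] using ruep_two_mul_add_two k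

lemma hankelNegRuep_sq_and_g_sq (n : ℕ) : hankelNegRuep n ^ 2 = 1 ∧ g n ^ 2 = 1 := by
  induction n using Nat.strong_induction_on with
  | _ n ih =>
    rcases Nat.eq_zero_or_pos n with rfl | hn
    · simp [hankelNegRuep, g, hankel_zero]
    obtain ⟨m, rfl | rfl⟩ := Nat.even_or_odd' n
    · obtain ⟨h1, h2⟩ := ih m (by omega)
      refine ⟨?_, ?_⟩
      · rw [hankelNegRuep_two_mul_eq_sq, h1, mul_one, ← pow_mul, mul_comm, pow_mul]; simp
      · rw [two_mul, g_add m m le_rfl (by omega), mul_pow, h1, h2, one_mul]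
    · obtain ⟨-, h2⟩ := ih m (by omega)
      have h1 : hankelNegRuep (2 * m + 1) ^ 2 = 1 := by
        rw [hankelNegRuep_two_mul_add_one_eq_g_sq, h2, mul_one, neg_sq, ← pow_mul, mul_comm,
          pow_mul]
        simp
      refine ⟨h1, ?_⟩
      rw [show 2 * m + 1 = (m + 1) + m by ring, g_add (m + 1) m (by omega) le_rfl, mul_pow, h2,
        mul_one]
      rcases Nat.eq_zero_or_pos m with rfl | hm
      · exact h1
      · exact (ih (m + 1) (by omega)).1

lemma hankelNegRuep_two_mul (m : ℕ) : hankelNegRuep (2 * m) = (-1) ^ m := by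
  rw [hankelNegRuep_two_mul_eq_sq, (hankelNegRuep_sq_and_g_sq m).1, mul_one]

lemma hankelNegRuep_two_mul_add_one (m : ℕ) : hankelNegRuep (2 * m + 1) = -(-1) ^ m := by
  rw [hankelNegRuep_two_mul_add_one_eq_g_sq, (hankelNegRuep_sq_and_g_sq m).2, mul_one]

lemma hankelNegRuepShiftTwo_two_mul (m : ℕ) : hankelNegRuepShiftTwo (2 * m) = (-1) ^ m := by
  rw [hankelNegRuepShiftTwo_two_mul_eq_g_sq, (hankelNegRuep_sq_and_g_sq m).2, mul_one]

lemma h_add (p q : ℕ) (hqp : q ≤ p) (hpq : p ≤ q + 1) :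
    h ((p + 1) + (q + 1)) =
      h (p + 1) * hankelNegRuep (q + 1) - g p * hankelNegRuepShiftTwo q := by
  have hcorner (m n : ℕ) : (Matrix.of fun (i : Fin (m + 1)) (j : Fin (n + 1)) =>
      bseq (2 * (i.1 + j.1) + 1)) = -Matrix.single 0 0 1 := by
    ext i j
    refine Fin.cases ?_ (fun i => ?_) i
    · refine Fin.cases ?_ (fun j => ?_) j
      · simp [bseq_add_one, ruep_zero]
      · simp [bseq_add_one, mul_add, ruep_two_mul_add_two,
          (Fin.succ_ne_zero j).symm]
    · simp only [Matrix.of_apply, bseq_add_one, Fin.val_succ]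
      rw [show 2 * (i.1 + 1 + j.1) = 2 * (i.1 + j.1) + 2 by ring, ruep_two_mul_add_two]
      simp [(Fin.succ_ne_zero i).symm]
  rw [h, hankel_eq_det_parity_blocks _ (p + 1) (q + 1) (by omega) (by omega), hcorner, hcorner,
    det_fromBlocks_neg_corner]
  have hodd (k : ℕ) : bseq (2 * k + 2) = -ruep k := by
    rw [bseq_add_one, ruep_two_mul_add_one]
  have hg : ((Matrix.of fun i j : Fin (p + 1) => bseq (2 * (i.1 + j.1))).submatrix
      Fin.succ Fin.succ).det = g p := by
    rw [g, hankel]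
    congr 1
    ext i j
    simp only [Matrix.submatrix_apply, Matrix.of_apply, Fin.val_succ, bseq_two_mul]
    rw [show i.1 + 1 + (j.1 + 1) = i.1 + j.1 + 1 + 1 by ring, bseq_add_one]
  have hk : ((Matrix.of fun i j : Fin (q + 1) => bseq (2 * (i.1 + j.1) + 2)).submatrix
      Fin.succ Fin.succ).det = hankelNegRuepShiftTwo q := by
    rw [hankelNegRuepShiftTwo, hankel]
    congr 1
    ext i j
    simp only [Matrix.submatrix_apply, Matrix.of_apply, Fin.val_succ, hodd]
    rw [show i.1 + 1 + (j.1 + 1) = i.1 + j.1 + 2 by ring]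
  rw [hg, hk]
  simp only [bseq_two_mul, hodd]
  rfl

lemma h_four_mul (n : ℕ) : h (4 * n) = (-1) ^ n * h (2 * n) := by
  cases n with
  | zero => simp
  | succ n =>
    rw [show 4 * (n + 1) = (2 * n + 1 + 1) + (2 * n + 1 + 1) by ring,
      h_add _ _ le_rfl (by omega), hankelNegRuepShiftTwo_two_mul_add_one,
      show 2 * n + 1 + 1 = 2 * (n + 1) by ring, hankelNegRuep_two_mul]
    ring

lemma h_four_mul_add_one (n : ℕ) : h (4 * n + 1) = (-1) ^ n * h (2 * n + 1) := by
  cases n with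
  | zero => simp
  | succ n =>
    rw [show 4 * (n + 1) + 1 = (2 * n + 2 + 1) + (2 * n + 1 + 1) by ring,
      h_add _ _ (by omega) (by omega), hankelNegRuepShiftTwo_two_mul_add_one,
      show 2 * n + 1 + 1 = 2 * (n + 1) by ring, hankelNegRuep_two_mul]
    ring

lemma h_four_mul_add_two (n : ℕ) :
    h (4 * n + 2) = -(-1) ^ n * h (2 * n + 1) - (-1) ^ n * g (2 * n) := by
  rw [show 4 * n + 2 = (2 * n + 1) + (2 * n + 1) by ring, h_add _ _ le_rfl (by omega),
    hankelNegRuep_two_mul_add_one, hankelNegRuepShiftTwo_two_mul]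
  ring

lemma h_four_mul_add_three (n : ℕ) :
    h (4 * n + 3) = -(-1) ^ n * h (2 * n + 2) - (-1) ^ n * g (2 * n + 1) := by
  rw [show 4 * n + 3 = (2 * n + 1 + 1) + (2 * n + 1) by ring, h_add _ _ (by omega) (by omega),
    hankelNegRuep_two_mul_add_one, hankelNegRuepShiftTwo_two_mul]
  ring

lemma g_four_mul (n : ℕ) : g (4 * n) = (-1) ^ n * g (2 * n) := by
  rw [show 4 * n = 2 * n + 2 * n by ring, g_add _ _ le_rfl (by omega), hankelNegRuep_two_mul]

lemma g_four_mul_add_one (n : ℕ) : g (4 * n + 1) = -(-1) ^ n * g (2 * n) := by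
  rw [show 4 * n + 1 = (2 * n + 1) + 2 * n by ring, g_add _ _ (by omega) (by omega),
    hankelNegRuep_two_mul_add_one]

lemma g_four_mul_add_two (n : ℕ) : g (4 * n + 2) = -(-1) ^ n * g (2 * n + 1) := by
  rw [show 4 * n + 2 = (2 * n + 1) + (2 * n + 1) by ring, g_add _ _ le_rfl (by omega),
    hankelNegRuep_two_mul_add_one]

lemma g_four_mul_add_three (n : ℕ) : g (4 * n + 3) = -(-1) ^ n * g (2 * n + 1) := by
  rw [show 4 * n + 3 = 2 * (n + 1) + (2 * n + 1) by ring, g_add _ _ (by omega) (by omega),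
    hankelNegRuep_two_mul]
  ring

lemma h_two_mul_add_h_two_mul_add_g (n : ℕ) :
    h (2 * n + 2) + (-1) ^ n * h (2 * n + 1) + g (2 * n) = 0 := by
  obtain ⟨p, rfl | rfl⟩ := Nat.even_or_odd' n
  · rw [show 2 * (2 * p) = 4 * p by ring, h_four_mul_add_two, h_four_mul_add_one, g_four_mul]
    simp only [pow_mul, neg_one_sq, one_pow]
    ring
  · rw [show 2 * (2 * p + 1) + 2 = 4 * (p + 1) by ring,
      show 2 * (2 * p + 1) + 1 = 4 * p + 3 by ring, show 2 * (2 * p + 1) = 4 * p + 2 by ring,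
      h_four_mul, h_four_mul_add_three, g_four_mul_add_two]
    simp only [pow_mul, pow_succ, pow_zero]
    ring_nf

theorem stmt15 :
    ∀ n : ℕ,
      h (8 * n) = h (4 * n) ∧
      h (8 * n + 1) = h (4 * n + 1) ∧
      h (8 * n + 2) = h (4 * n + 2) ∧
      h (8 * n + 3) = -h (4 * n + 1) - 2 * h (4 * n + 2) ∧
      h (8 * n + 4) = -h (4 * n + 2) ∧
      h (8 * n + 5) = -h (4 * n + 3) ∧
      h (8 * n + 6) = -h (2 * n + 1) + h (4 * n + 1) + h (4 * n + 2)
        + 2 * h (4 * n + 3) ∧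
      h (8 * n + 7) = h (4 * n + 3) := by
  intro n
  have hE : (-1 : ℤ) ^ (2 * n) = 1 := by simp
  have hO : (-1 : ℤ) ^ (2 * n + 1) = -1 := by simp [pow_succ]
  have hsq : ((-1 : ℤ) ^ n) ^ 2 = 1 := by rw [← pow_mul, mul_comm, hE]
  have e0 := h_four_mul (2 * n)
  have e1 := h_four_mul_add_one (2 * n)
  have e2 := h_four_mul_add_two (2 * n)
  have e3 := h_four_mul_add_three (2 * n)
  have e4 := h_four_mul (2 * n + 1)
  have e5 := h_four_mul_add_one (2 * n + 1)
  have e6 := h_four_mul_add_two (2 * n + 1)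
  have e7 := h_four_mul_add_three (2 * n + 1)
  have e8 := h_four_mul (n + 1)
  rw [hE] at e0 e1 e2 e3
  rw [hO] at e4 e5 e6 e7
  rw [pow_succ] at e8
  have f1 := h_four_mul_add_one n
  have f2 := h_four_mul_add_two n
  have f3 := h_four_mul_add_three n
  have g0 := g_four_mul n
  have g1 := g_four_mul_add_one n
  have g2 := g_four_mul_add_two n
  have g3 := g_four_mul_add_three n
  have hs := h_two_mul_add_h_two_mul_add_g n
  simp only [mul_add, ← mul_assoc, add_assoc, Nat.reduceMul, Nat.reduceAdd, mul_one] at *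
  refine ⟨?_, ?_, ?_, ?_, ?_, ?_, ?_, ?_⟩
  · linarith
  · linarith
  · linarith
  · linarith
  · linarith
  · linarith
  · linear_combination e6 + g2 - f1 - f2 - f3 + (-1) ^ n * hs - h (2 * n + 1) * hsq
  · linarith
end
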